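/- Let φ be a 3×3 matrix over S whose entries are homogeneous linear forms and whose determinant is f₄. Then there exist invertible 3×3 matrices U, V over S with det U = det V = 1, indices i, j ∈ {2,3,4}, linearly independent linear forms α, γ ∈ 𝓛₁, β ∈ 𝓛_j, δ ∈ 𝓛_i, and linear forms m, n, w, t in S, such that U φ V = [[0, α, β],[γ, m, n],[δ, w, t]]. -/

import Mathlib

open MvPolynomial Matrix TensorProduct

set_option maxHeartbeats 1000000
set_option synthInstance.maxHeartbeats 400000

noncomputable section

/-- The polynomial ring `S = K[Y₁,Y₂,Y₃,Y₄]`. -/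
abbrev S (K : Type) [Field K] := MvPolynomial (Fin 4) K

/-- The variables `Y₁,…,Y₄` (indexed by `1,…,4`). -/
def Yv (K : Type) [Field K] : ℕ → S K
  | 1 => X 0
  | 2 => X 1
  | 3 => X 2
  | 4 => X 3
  | _ => 0

/-- `f₄ = Y₁³+Y₂³+Y₃³+Y₄³`. -/
def f4 (K : Type) [Field K] : S K :=
  Yv K 1 ^ 3 + Yv K 2 ^ 3 + Yv K 3 ^ 3 + Yv K 4 ^ 3

/-- The hypersurface ring `R₄ = S/(f₄)`. -/
abbrev R4 (K : Type) [Field K] := S K ⧸ Ideal.span {f4 K}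

/-- The canonical projection `S → R₄`. -/
abbrev proj (K : Type) [Field K] : S K →+* R4 K := Ideal.Quotient.mk (Ideal.span {f4 K})

/-- The `R₄`-linear map `R₄ⁿ → R₄ⁿ` induced by an `n × n` matrix over `S`. -/
abbrev mbar (K : Type) [Field K] {n : ℕ} (M : Matrix (Fin n) (Fin n) (S K)) :
    (Fin n → R4 K) →ₗ[R4 K] (Fin n → R4 K) :=
  Matrix.mulVecLin (M.map ⇑(proj K))

/-- The cokernel of the `R₄`-linear map induced by a matrix over `S`. -/
abbrev coker (K : Type) [Field K] {n : ℕ} (M : Matrix (Fin n) (Fin n) (S K)) :=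
  (Fin n → R4 K) ⧸ LinearMap.range (mbar K M)

/-- The matrix `φ_ij(a,b)`. -/
def phiM (K : Type) [Field K] (a b : K) (i j s : ℕ) : Matrix (Fin 2) (Fin 2) (S K) :=
  !![Yv K 1 - C a * Yv K s, -(Yv K i ^ 2 + C b * Yv K i * Yv K j + C b ^ 2 * Yv K j ^ 2);
     Yv K i - C b * Yv K j, Yv K 1 ^ 2 + C a * Yv K 1 * Yv K s + C a ^ 2 * Yv K s ^ 2]

/-- The matrix `ψ_ij(a,b)`. -/
def psiM (K : Type) [Field K] (a b : K) (i j s : ℕ) : Matrix (Fin 2) (Fin 2) (S K) :=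
  !![Yv K 1 ^ 2 + C a * Yv K 1 * Yv K s + C a ^ 2 * Yv K s ^ 2,
       Yv K i ^ 2 + C b * Yv K i * Yv K j + C b ^ 2 * Yv K j ^ 2;
     -(Yv K i - C b * Yv K j), Yv K 1 - C a * Yv K s]

/-- The set `𝓛_i` of linear forms `Y_i - a Y_j` with `a³ = -1` and `i < j ≤ 4`. -/
def Lset (K : Type) [Field K] (i : ℕ) : Set (S K) :=
  {p | ∃ (a : K) (j : ℕ), a ^ 3 = -1 ∧ i < j ∧ j ≤ 4 ∧ p = Yv K i - C a * Yv K j}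

/-- The matrix `α(b,c,d,ε)`, where `a = ε²bcd`. -/
def alphaM (K : Type) [Field K] (b c d ε : K) : Matrix (Fin 3) (Fin 3) (S K) :=
  let a := ε ^ 2 * b * c * d
  !![0, Yv K 1 - C a * Yv K 4, Yv K 2 - C b * Yv K 3;
     Yv K 1 - C c * Yv K 2, -(C (b ^ 2) * Yv K 3) - C (a * b * c ^ 2 * ε ^ 2) * Yv K 4,
       C (b ^ 2 * c ^ 2) * Yv K 3 - C (a * b * c * ε ^ 2) * Yv K 4;
     Yv K 3 - C d * Yv K 4, C (c ^ 2) * Yv K 2 + C (b * c ^ 2) * Yv K 3 + C (a * c) * Yv K 4,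
       -(Yv K 1) - C c * Yv K 2 - C a * Yv K 4]

/-- The matrix `β(b,c,d,ε)`, the transpose of `α(b,c,d,ε)`. -/
def betaM (K : Type) [Field K] (b c d ε : K) : Matrix (Fin 3) (Fin 3) (S K) :=
  (alphaM K b c d ε).transpose

/-- The matrix `η(a,b,c,ε)`. -/
def etaM (K : Type) [Field K] (a b c ε : K) : Matrix (Fin 3) (Fin 3) (S K) :=
  !![0, Yv K 1 + Yv K 2, Yv K 3 - C a * Yv K 4;
     Yv K 1 + C ε * Yv K 2, -(Yv K 3) + C c * Yv K 4, 0;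
     Yv K 3 - C b * Yv K 4, 0, -(Yv K 1) - C (ε ^ 2) * Yv K 2]

/-- The matrix `θ(a,b,c)` (denoted `ϑ(a,b,c)` in the paper). -/
def thetaM (K : Type) [Field K] (a b c : K) : Matrix (Fin 3) (Fin 3) (S K) :=
  !![0, Yv K 1 + Yv K 3, Yv K 2 - C a * Yv K 4;
     Yv K 1 - C (a ^ 2 * b) * Yv K 3, -(Yv K 2) + C c * Yv K 4, 0;
     Yv K 2 - C b * Yv K 4, 0, -(Yv K 1) + C (a * b ^ 2) * Yv K 3]

/-- The matrix `D((a,b,c),(p,q,r))`. -/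
def DM (K : Type) [Field K] (a b c p q r : K) : Matrix (Fin 3) (Fin 3) (S K) :=
  !![0, Yv K 1 - C a * Yv K 2, Yv K 3 - C p * Yv K 4;
     Yv K 1 - C c * Yv K 2, -(Yv K 3) + C r * Yv K 4, 0;
     Yv K 3 - C q * Yv K 4, 0, -(Yv K 1) + C b * Yv K 2]

/-- `(a,b,c)` is a permutation (i.e. an enumeration) of the three cube roots of `-1` in `K`. -/
def cubePerm (K : Type) [Field K] (a b c : K) : Prop :=
  a ^ 3 = -1 ∧ b ^ 3 = -1 ∧ c ^ 3 = -1 ∧ a ≠ b ∧ a ≠ c ∧ b ≠ c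



-- linear-algebra core
theorem twoByTwo {K : Type} [Field K] [IsAlgClosed K] (P Q : Matrix (Fin 2) (Fin 2) K) :
    ∃ a b : Fin 2 → K, a ≠ 0 ∧ b ≠ 0 ∧ a ⬝ᵥ (P *ᵥ b) = 0 ∧ a ⬝ᵥ (Q *ᵥ b) = 0 := by
  -- find a with rows a P, a Q dependent
  have key : ∃ a : Fin 2 → K, a ≠ 0 ∧ (Matrix.of ![a ᵥ* P, a ᵥ* Q]).det = 0 := by
    set e2 := P 0 0 * Q 0 1 - P 0 1 * Q 0 0 with he2
    set e1 := P 0 0 * Q 1 1 + P 1 0 * Q 0 1 - P 0 1 * Q 1 0 - P 1 1 * Q 0 0 with he1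
    set e0 := P 1 0 * Q 1 1 - P 1 1 * Q 1 0 with he0
    by_cases h : e2 = 0
    · refine ⟨![1, 0], fun h => by simpa using congrFun h 0, ?_⟩
      simp [Matrix.det_fin_two, Matrix.vecMul, dotProduct, Fin.sum_univ_two]
      rw [← h]
    · obtain ⟨x, hx⟩ := IsAlgClosed.exists_root (Polynomial.C e2 * Polynomial.X ^ 2 + Polynomial.C e1 * Polynomial.X + Polynomial.C e0) (by
        rw [Polynomial.degree_quadratic h]; norm_num)
      simp [Polynomial.IsRoot] at hx
      refine ⟨![x, 1], fun h => by simpa using congrFun h 1, ?_⟩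
      simp [Matrix.det_fin_two, Matrix.vecMul, dotProduct, Fin.sum_univ_two]
      rw [← hx, he0, he1, he2]; ring
  obtain ⟨a, ha, hd⟩ := key
  obtain ⟨b, hb, hm⟩ := Matrix.exists_mulVec_eq_zero_iff.mpr hd
  refine ⟨a, b, ha, hb, ?_, ?_⟩
  · have := congrFun hm 0
    rw [Matrix.dotProduct_mulVec]; exact this
  · have := congrFun hm 1
    rw [Matrix.dotProduct_mulVec]; exact this

theorem exists_sol {K : Type} [Field K] {m n : ℕ} (h : m < n) (M : Matrix (Fin m) (Fin n) K) :
    ∃ v, v ≠ 0 ∧ M *ᵥ v = 0 := by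
  have := LinearMap.ker_ne_bot_of_finrank_lt (f := M.mulVecLin) (by simpa using h)
  obtain ⟨v, hv, h0⟩ := (Submodule.ne_bot_iff _).mp this
  exact ⟨v, h0, by simpa using hv⟩

theorem core_last {K : Type} [Field K] [IsAlgClosed K] [CharZero K]
    (d : Fin 3 → K) (B X D : Matrix (Fin 3) (Fin 3) K) (c : K) (hc : c ≠ 0) (h2 : d 2 = 0)
    (h : ∀ s t p : K, (s • diagonal d + t • B + p • X).det = c * ((s + p) ^ 3 - s ^ 3)) :
    ∃ u v : Fin 3 → K, u ≠ 0 ∧ v ≠ 0 ∧ u ⬝ᵥ (diagonal d *ᵥ v) = 0 ∧ u ⬝ᵥ (B *ᵥ v) = 0 ∧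
      u ⬝ᵥ (X *ᵥ v) = 0 ∧ u ⬝ᵥ (D *ᵥ v) = 0 := by
  have hd : d 0 * d 1 ≠ 0 := by
    intro h01
    have e1 := h 1 0 1
    have e2 := h 1 0 (-1)
    have e3 := h 1 0 2
    simp [Matrix.det_fin_three, diagonal_apply, h2] at e1 e2 e3
    apply hc
    grind
  have hd0 : d 0 ≠ 0 := left_ne_zero_of_mul hd
  have hd1 : d 1 ≠ 0 := right_ne_zero_of_mul hd
  have e0 := h 0 1 0
  have e1 := h 1 1 0
  have e2 := h (-1) 1 0
  simp [Matrix.det_fin_three, diagonal_apply, h2] at e0 e1 e2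
  have b22 : B 2 2 = 0 := by
    have : d 0 * d 1 * B 2 2 = 0 := by grind
    simpa [hd0, hd1] using this
  have hrc : d 0 * B 1 2 * B 2 1 + d 1 * B 0 2 * B 2 0 = 0 := by grind
  by_cases hr : B 2 0 = 0 ∧ B 2 1 = 0
  · obtain ⟨v, hv, hv0⟩ := exists_sol (by norm_num) (Matrix.of ![X 2, D 2])
    have h0 := congrFun hv0 0
    have h1 := congrFun hv0 1
    refine ⟨![0, 0, 1], v, fun h => by simpa using congrFun h 2, hv, ?_, ?_, ?_, ?_⟩ <;>
    simp_all [Matrix.mulVec, dotProduct, Fin.sum_univ_three, diagonal_apply]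
  by_cases hl : B 0 2 = 0 ∧ B 1 2 = 0
  · obtain ⟨v, hv, hv0⟩ := exists_sol (by norm_num) (Matrix.of ![fun i => X i 2, fun i => D i 2])
    have h0 := congrFun hv0 0
    have h1 := congrFun hv0 1
    refine ⟨v, ![0, 0, 1], hv, fun h => by simpa using congrFun h 2, ?_, ?_, ?_, ?_⟩ <;>
    simp_all [Matrix.mulVec, dotProduct, Fin.sum_univ_three, diagonal_apply, mul_comm]
  -- general case
  have hM : B 1 2 * (B 0 0 * (B 0 2 * d 1) + B 0 1 * (B 1 2 * d 0))
      = B 0 2 * (B 1 0 * (B 0 2 * d 1) + B 1 1 * (B 1 2 * d 0)) := by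
    by_cases h02 : B 0 2 = 0
    · have h12 : B 1 2 ≠ 0 := fun h => hl ⟨h02, h⟩
      have : B 2 1 = 0 := by simpa [h02, hd0, h12] using hrc
      grind
    · have : B 2 0 = - (d 0 * B 1 2 * B 2 1) / (d 1 * B 0 2) := by field_simp; grind
      have h21 : B 2 1 ≠ 0 := by
        intro h
        apply hr
        simp [this, h]
      have h3 : B 2 1 * (B 1 2 * (B 0 0 * (B 0 2 * d 1) + B 0 1 * (B 1 2 * d 0))
      - B 0 2 * (B 1 0 * (B 0 2 * d 1) + B 1 1 * (B 1 2 * d 0))) = 0 := by grind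
      exact sub_eq_zero.mp ((mul_eq_zero.mp h3).resolve_left h21)
  let U : Matrix (Fin 2) (Fin 3) K := !![-B 1 2, B 0 2, 0; 0, 0, 1]
  let W : Matrix (Fin 3) (Fin 2) K := !![B 0 2 * d 1, 0; B 1 2 * d 0, 0; 0, 1]
  obtain ⟨a, b, ha, hb, h3, h4⟩ := twoByTwo (U * X * W) (U * D * W)
  have conv : ∀ Z : Matrix (Fin 3) (Fin 3) K, (a ᵥ* U) ⬝ᵥ (Z *ᵥ (W *ᵥ b)) = a ⬝ᵥ ((U * Z * W) *ᵥ b) := by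
    intro Z
    rw [← Matrix.mulVec_mulVec, ← Matrix.mulVec_mulVec, Matrix.dotProduct_mulVec a]
  refine ⟨a ᵥ* U, W *ᵥ b, ?_, ?_, ?_, ?_, ?_, ?_⟩
  · intro h
    apply ha
    have g0 := congrFun h 0
    have g1 := congrFun h 1
    have g2 := congrFun h 2
    simp [U, Matrix.vecMul, dotProduct, Fin.sum_univ_two] at g0 g1 g2
    ext i; fin_cases i <;> simp <;> grind
  · intro h
    apply hb
    have g0 := congrFun h 0
    have g1 := congrFun h 1
    have g2 := congrFun h 2
    simp [W, Matrix.mulVec, dotProduct, Fin.sum_univ_two] at g0 g1 g2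
    ext i; fin_cases i <;> simp <;> grind
  · rw [conv]
    have : U * diagonal d * W = 0 := by
      ext i j; fin_cases i <;> fin_cases j <;> simp [U, W, Matrix.mul_apply, Matrix.vecMul, dotProduct, Fin.sum_univ_three, diagonal_apply] <;> grind
    simp [this]
  · rw [conv]
    have : U * B * W = 0 := by
      ext i j; fin_cases i <;> fin_cases j <;> simp [U, W, Matrix.mul_apply, Matrix.vecMul, dotProduct, Fin.sum_univ_three, b22] <;> grind
    simp [this]
  · rw [conv, h3]
  · rw [conv, h4]

theorem core_diag {K : Type} [Field K] [IsAlgClosed K] [CharZero K]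
    (d : Fin 3 → K) (B X D : Matrix (Fin 3) (Fin 3) K) (c : K) (hc : c ≠ 0)
    (h : ∀ s t p : K, (s • diagonal d + t • B + p • X).det = c * ((s + p) ^ 3 - s ^ 3)) :
    ∃ u v : Fin 3 → K, u ≠ 0 ∧ v ≠ 0 ∧ u ⬝ᵥ (diagonal d *ᵥ v) = 0 ∧ u ⬝ᵥ (B *ᵥ v) = 0 ∧
      u ⬝ᵥ (X *ᵥ v) = 0 ∧ u ⬝ᵥ (D *ᵥ v) = 0 := by
  have h0 := h 1 0 0
  obtain ⟨i, hi⟩ : ∃ i, d i = 0 := by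
    simpa [Matrix.det_diagonal, Finset.prod_eq_zero_iff] using h0
  let σ : Equiv.Perm (Fin 3) := Equiv.swap i 2
  have hdiag : (diagonal d).submatrix σ σ = diagonal (d ∘ σ) := by
    simp [Matrix.submatrix_diagonal_equiv]
  obtain ⟨u, v, hu, hv, h1, h2, h3, h4⟩ := core_last (d ∘ σ) (B.submatrix σ σ) (X.submatrix σ σ)
    (D.submatrix σ σ) c hc (by simp [σ, hi]) (by
      intro s t p
      rw [← h s t p, ← hdiag, ← Matrix.det_submatrix_equiv_self σ (s • diagonal d + t • B + p • X)]
      rfl)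
  have conv : ∀ Z : Matrix (Fin 3) (Fin 3) K, (u ∘ σ.symm) ⬝ᵥ (Z *ᵥ (v ∘ σ.symm)) = u ⬝ᵥ (Z.submatrix σ σ *ᵥ v) := by
    intro Z
    rw [Matrix.submatrix_mulVec_equiv, _root_.comp_equiv_symm_dotProduct]
  refine ⟨u ∘ σ.symm, v ∘ σ.symm, ?_, ?_, ?_, ?_, ?_, ?_⟩
  · intro h; apply hu; ext j; simpa using congrFun h (σ j)
  · intro h; apply hv; ext j; simpa using congrFun h (σ j)
  · rw [conv, hdiag, h1]
  · rw [conv, h2]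
  · rw [conv, h3]
  · rw [conv, h4]

theorem core {K : Type} [Field K] [IsAlgClosed K] [CharZero K]
    (A B X D : Matrix (Fin 3) (Fin 3) K)
    (h : ∀ s t p : K, (s • A + t • B + p • X).det = ((s + p) ^ 3 - s ^ 3)) :
    ∃ u v : Fin 3 → K, u ≠ 0 ∧ v ≠ 0 ∧ u ⬝ᵥ (A *ᵥ v) = 0 ∧ u ⬝ᵥ (B *ᵥ v) = 0 ∧
      u ⬝ᵥ (X *ᵥ v) = 0 ∧ u ⬝ᵥ (D *ᵥ v) = 0 := by
  obtain ⟨L, L', d, hL⟩ := Matrix.Pivot.exists_list_transvec_mul_mul_list_transvec_eq_diagonal A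
  set P := (L.map TransvectionStruct.toMatrix).prod with hP
  set Q := (L'.map TransvectionStruct.toMatrix).prod with hQ
  have dP : P.det = 1 := TransvectionStruct.det_toMatrix_prod L
  have dQ : Q.det = 1 := TransvectionStruct.det_toMatrix_prod L'
  obtain ⟨u, v, hu, hv, h1, h2, h3, h4⟩ := core_diag d (P * B * Q) (P * X * Q) (P * D * Q) 1 one_ne_zero (by
    intro s t p
    rw [one_mul, ← h s t p, ← hL]
    have : s • (P * A * Q) + t • (P * B * Q) + p • (P * X * Q) = P * (s • A + t • B + p • X) * Q := by
      simp [Matrix.mul_add, Matrix.add_mul]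
    rw [this, Matrix.det_mul, Matrix.det_mul, dP, dQ]; ring)
  have conv : ∀ Z : Matrix (Fin 3) (Fin 3) K, (u ᵥ* P) ⬝ᵥ (Z *ᵥ (Q *ᵥ v)) = u ⬝ᵥ ((P * Z * Q) *ᵥ v) := by
    intro Z
    rw [← Matrix.mulVec_mulVec, ← Matrix.mulVec_mulVec, Matrix.dotProduct_mulVec u]
  refine ⟨u ᵥ* P, Q *ᵥ v, ?_, ?_, ?_, ?_, ?_, ?_⟩
  · intro h; exact hu (Matrix.eq_zero_of_vecMul_eq_zero (by simp [dP]) h)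
  · intro h; exact hv (Matrix.eq_zero_of_mulVec_eq_zero (by simp [dQ]) h)
  · rw [conv, hL, h1]
  · rw [conv, h2]
  · rw [conv, h3]
  · rw [conv, h4]

theorem exists_row {K : Type} [Field K] (u : Fin 3 → K) (hu : u ≠ 0) :
    ∃ P : Matrix (Fin 3) (Fin 3) K, P.det ≠ 0 ∧ P 0 = u := by
  by_cases h0 : u 0 = 0
  · by_cases h1 : u 1 = 0
    · have h2 : u 2 ≠ 0 := fun h2 => hu (by ext i; fin_cases i <;> simp [*])
      exact ⟨Matrix.of ![u, ![1,0,0], ![0,1,0]], by simp [Matrix.det_fin_three, *], rfl⟩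
    · exact ⟨Matrix.of ![u, ![1,0,0], ![0,0,1]], by simp [Matrix.det_fin_three, *], rfl⟩
  · exact ⟨Matrix.of ![u, ![0,1,0], ![0,0,1]], by simp [Matrix.det_fin_three, *], rfl⟩

theorem lin_form {K : Type} [Field K] {p : S K} (hp : p.IsHomogeneous 1) :
    ∃ c : Fin 4 → K, p = C (c 0) * X 0 + C (c 1) * X 1 + C (c 2) * X 2 + C (c 3) * X 3 := by
  have h : p ∈ homogeneousSubmodule (Fin 4) K 1 := hp
  rw [homogeneousSubmodule_one_eq_span_X, Submodule.mem_span_range_iff_exists_fun] at h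
  obtain ⟨c, hc⟩ := h
  exact ⟨c, by rw [← hc, Fin.sum_univ_four]; simp [MvPolynomial.smul_eq_C_mul]⟩

theorem eval_f4 {K : Type} [Field K] (P : Fin 4 → K) :
    eval P (f4 K) = P 0 ^ 3 + P 1 ^ 3 + P 2 ^ 3 + P 3 ^ 3 := by
  simp [f4, Yv]

theorem smooth {K : Type} [Field K] [CharZero K] (x y z p m n w t : S K) (c : K) (hc : c ≠ 0)
    (h : C c * f4 K = -x * (z * t - n * p) + y * (z * w - m * p)) (P : Fin 4 → K)
    (hx : eval P x = 0) (hy : eval P y = 0) (hz : eval P z = 0) (hp : eval P p = 0) : P = 0 := by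
  ext i
  have h1 := congrArg (fun q => eval P (pderiv i q)) h
  simp [hx, hy, hz, hp, Derivation.leibniz, hc] at h1
  fin_cases i <;> simpa [f4, Yv, Derivation.leibniz, Derivation.leibniz_pow, pderiv_X] using h1

theorem indep {K : Type} [Field K] [CharZero K] (x y z p m n w t : S K) (c : K) (hc : c ≠ 0)
    (hx : x.IsHomogeneous 1) (hy : y.IsHomogeneous 1) (hz : z.IsHomogeneous 1)
    (hp : p.IsHomogeneous 1)
    (h : C c * f4 K = -x * (z * t - n * p) + y * (z * w - m * p)) :
    LinearIndependent K ![x, y, z, p] := by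
  obtain ⟨cx, rx⟩ := lin_form hx
  obtain ⟨cy, ry⟩ := lin_form hy
  obtain ⟨cz, rz⟩ := lin_form hz
  obtain ⟨cp, rp⟩ := lin_form hp
  let M : Matrix (Fin 4) (Fin 4) K := Matrix.of ![cx, cy, cz, cp]
  have hM : M.det ≠ 0 := by
    intro h0
    obtain ⟨P, hP, hM⟩ := Matrix.exists_mulVec_eq_zero_iff.mpr h0
    apply hP
    have g0 := congrFun hM 0
    have g1 := congrFun hM 1
    have g2 := congrFun hM 2
    have g3 := congrFun hM 3
    simp [M, Matrix.mulVec, dotProduct, Fin.sum_univ_four] at g0 g1 g2 g3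
    refine smooth x y z p m n w t c hc h P ?_ ?_ ?_ ?_
    · simpa [rx] using g0
    · simpa [ry] using g1
    · simpa [rz] using g2
    · simpa [rp] using g3
  rw [Fintype.linearIndependent_iff]
  intro g hg
  have hv : g ᵥ* M = 0 := by
    ext i
    have e := congrArg (fun q => eval (Pi.single i 1) q) hg
    simp [Fin.sum_univ_four, rx, ry, rz, rp] at e
    fin_cases i <;> simpa [M, Matrix.vecMul, dotProduct, Fin.sum_univ_four] using e
  have := Matrix.eq_zero_of_vecMul_eq_zero hM hv
  intro i; simp [this]

theorem scal {K : Type} [Field K] {p2 p3 p4 q1 q2 q3 : K} (h4 : p4 ≠ 0)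
    (hq : ¬ (q1 = 0 ∧ q2 = 0 ∧ q3 = 0)) (e0 : p2 ^ 3 + p3 ^ 3 + p4 ^ 3 = 0)
    (e1 : p2 ^ 2 * q2 + p3 ^ 2 * q3 = 0) (e2 : p2 * q2 ^ 2 + p3 * q3 ^ 2 = 0)
    (e3 : q1 ^ 3 + q2 ^ 3 + q3 ^ 3 = 0) : (p2 = 0 ∧ q3 = 0) ∨ (p3 = 0 ∧ q2 = 0) := by
  have n4 : p4 ^ 3 ≠ 0 := pow_ne_zero _ h4
  by_cases h2 : p2 = 0
  · left
    refine ⟨h2, ?_⟩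
    have h3 : p3 ≠ 0 := by rintro rfl; apply n4; simpa [h2] using e0
    simpa [h2, h3] using e1
  by_cases h3 : p3 = 0
  · right
    refine ⟨h3, ?_⟩
    simpa [h2, h3] using e1
  exfalso
  have k2 : q2 = 0 := by
    by_contra k2
    have k3 : q3 ≠ 0 := by rintro rfl; simp [h2, k2] at e1
    have r : p2 * q3 = p3 * q2 := by
      have : p2 * q2 * (p2 * q3 - p3 * q2) = 0 := by linear_combination q3 * e1 - p3 * e2
      have := (mul_eq_zero.mp this).resolve_left (mul_ne_zero h2 k2)
      exact sub_eq_zero.mp this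
    have : q2 * p4 ^ 3 = 0 := by
      linear_combination q2 * e0 - p2 * e1 + p3 ^ 2 * r
    exact n4 ((mul_eq_zero.mp this).resolve_left k2)
  have k3 : q3 = 0 := by simpa [k2, h3] using e1
  apply hq
  simpa [k2, k3] using e3

/-- Final shape of a pair of points spanning a line. -/
theorem fin_shape {K : Type} [Field K] {P Q : Fin 4 → K} (hP : P ≠ 0) (hQ : Q ≠ 0)
    (s j k : Fin 4) (hs : ∀ i, i = 0 ∨ i = s ∨ i = j ∨ i = k)
    (P0 : P 0 = 0) (Ps : P s = 0) (Qj : Q j = 0) (Qk : Q k = 0)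
    (cP : P j ^ 3 + P k ^ 3 = 0) (cQ : Q 0 ^ 3 + Q s ^ 3 = 0) :
    ∃ a b : K, a ^ 3 = -1 ∧ b ^ 3 = -1 ∧ ∀ w0 ws wj wk : K,
      wj * P j + wk * P k = 0 → w0 * Q 0 + ws * Q s = 0 → ws = - a * w0 ∧ wk = - b * wj := by
  have hk : P k ≠ 0 := by
    intro h
    apply hP
    have : P j = 0 := by simpa [h] using cP
    ext i
    rcases hs i with rfl | rfl | rfl | rfl <;> assumption
  have hs' : Q s ≠ 0 := by
    intro h
    apply hQ
    have : Q 0 = 0 := by simpa [h] using cQ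
    ext i
    rcases hs i with rfl | rfl | rfl | rfl <;> assumption
  refine ⟨Q 0 / Q s, P j / P k, ?_, ?_, ?_⟩
  · field_simp; linear_combination cQ
  · field_simp; linear_combination cP
  · intro w0 ws wj wk h1 h2
    constructor
    · field_simp; linear_combination h2
    · field_simp; linear_combination h1

theorem classify_num {K : Type} [Field K] [CharZero K] (x y : Fin 4 → K)
    (h : ∀ P : Fin 4 → K, x ⬝ᵥ P = 0 → y ⬝ᵥ P = 0 →
      P 0 ^ 3 + P 1 ^ 3 + P 2 ^ 3 + P 3 ^ 3 = 0) :
    ∃ (a b : K) (s j k : Fin 4), a ^ 3 = -1 ∧ b ^ 3 = -1 ∧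
      ((s = 1 ∧ j = 2 ∧ k = 3) ∨ (s = 2 ∧ j = 1 ∧ k = 3) ∨ (s = 3 ∧ j = 1 ∧ k = 2)) ∧
      x s = - a * x 0 ∧ x k = - b * x j ∧ y s = - a * y 0 ∧ y k = - b * y j := by
  obtain ⟨P, hP, hP0⟩ := exists_sol (by norm_num) (Matrix.of ![x, y, Pi.single 0 1])
  have hPx : x ⬝ᵥ P = 0 := congrFun hP0 0
  have hPy : y ⬝ᵥ P = 0 := congrFun hP0 1
  have P0 : P 0 = 0 := by simpa [Matrix.mulVec] using congrFun hP0 2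
  obtain ⟨l, hl⟩ : ∃ l, P l ≠ 0 := by
    by_contra! hh; exact hP (funext hh)
  obtain ⟨Q, hQ, hQ0⟩ := exists_sol (by norm_num) (Matrix.of ![x, y, Pi.single l 1])
  have hQx : x ⬝ᵥ Q = 0 := congrFun hQ0 0
  have hQy : y ⬝ᵥ Q = 0 := congrFun hQ0 1
  have Ql : Q l = 0 := by simpa [Matrix.mulVec] using congrFun hQ0 2
  have hh : ∀ s t : K, (s * P 0 + t * Q 0) ^ 3 + (s * P 1 + t * Q 1) ^ 3
      + (s * P 2 + t * Q 2) ^ 3 + (s * P 3 + t * Q 3) ^ 3 = 0 := by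
    intro s t
    have := h (s • P + t • Q) (by simp [dotProduct_add, dotProduct_smul, hPx, hQx])
      (by simp [dotProduct_add, dotProduct_smul, hPy, hQy])
    simpa using this
  have f10 := hh 1 0
  have f01 := hh 0 1
  have f11 := hh 1 1
  have f12 := hh 1 (-1)
  simp [P0] at f10 f01 f11 f12
  have g1 : P 1 ^ 2 * Q 1 + P 2 ^ 2 * Q 2 + P 3 ^ 2 * Q 3 = 0 := by
    have : 6 * (P 1 ^ 2 * Q 1 + P 2 ^ 2 * Q 2 + P 3 ^ 2 * Q 3) = 0 := by
      linear_combination f11 - f12 - 2 * f01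
    simpa using this
  have g2 : P 1 * Q 1 ^ 2 + P 2 * Q 2 ^ 2 + P 3 * Q 3 ^ 2 = 0 := by
    have : 6 * (P 1 * Q 1 ^ 2 + P 2 * Q 2 ^ 2 + P 3 * Q 3 ^ 2) = 0 := by
      linear_combination f11 + f12 - 2 * f10
    simpa using this
  simp only [dotProduct, Fin.sum_univ_four] at hPx hPy hQx hQy
  have key : (P 1 = 0 ∧ Q 2 = 0 ∧ Q 3 = 0) ∨ (P 2 = 0 ∧ Q 1 = 0 ∧ Q 3 = 0) ∨
      (P 3 = 0 ∧ Q 1 = 0 ∧ Q 2 = 0) := by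
    have hQ' : ¬ (Q 0 = 0 ∧ Q 1 = 0 ∧ Q 2 = 0 ∧ Q 3 = 0) := by
      rintro ⟨a, b, c, d⟩
      apply hQ
      ext i; fin_cases i <;> simpa
    fin_cases l
    · exact absurd P0 hl
    · simp at hl Ql
      have := scal (p2 := P 2) (p3 := P 3) (p4 := P 1) (q1 := Q 0) (q2 := Q 2) (q3 := Q 3) hl
        (by grind) (by linear_combination f10) (by simpa [Ql] using g1) (by simpa [Ql] using g2)
        (by simpa [Ql] using f01)
      grind
    · simp at hl Ql
      have := scal (p2 := P 1) (p3 := P 3) (p4 := P 2) (q1 := Q 0) (q2 := Q 1) (q3 := Q 3) hl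
        (by grind) (by linear_combination f10) (by simpa [Ql] using g1) (by simpa [Ql] using g2)
        (by simpa [Ql] using f01)
      grind
    · simp at hl Ql
      have := scal (p2 := P 1) (p3 := P 2) (p4 := P 3) (q1 := Q 0) (q2 := Q 1) (q3 := Q 2) hl
        (by grind) (by linear_combination f10) (by simpa [Ql] using g1) (by simpa [Ql] using g2)
        (by simpa [Ql] using f01)
      grind
  rcases key with ⟨h1, h2, h3⟩ | ⟨h1, h2, h3⟩ | ⟨h1, h2, h3⟩
  · obtain ⟨a, b, ha, hb, hw⟩ := fin_shape hP hQ 1 2 3 (by decide) P0 h1 h2 h3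
      (by simpa [h1] using f10) (by simpa [h2, h3] using f01)
    obtain ⟨u1, u2⟩ := hw (x 0) (x 1) (x 2) (x 3) (by simpa [P0, h1] using hPx) (by simpa [h2, h3] using hQx)
    obtain ⟨v1, v2⟩ := hw (y 0) (y 1) (y 2) (y 3) (by simpa [P0, h1] using hPy) (by simpa [h2, h3] using hQy)
    exact ⟨a, b, 1, 2, 3, ha, hb, by simp, u1, u2, v1, v2⟩
  · obtain ⟨a, b, ha, hb, hw⟩ := fin_shape hP hQ 2 1 3 (by decide) P0 h1 h2 h3
      (by simpa [h1] using f10) (by simpa [h2, h3] using f01)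
    obtain ⟨u1, u2⟩ := hw (x 0) (x 2) (x 1) (x 3) (by simpa [P0, h1] using hPx) (by simpa [h2, h3] using hQx)
    obtain ⟨v1, v2⟩ := hw (y 0) (y 2) (y 1) (y 3) (by simpa [P0, h1] using hPy) (by simpa [h2, h3] using hQy)
    exact ⟨a, b, 2, 1, 3, ha, hb, by simp, u1, u2, v1, v2⟩
  · obtain ⟨a, b, ha, hb, hw⟩ := fin_shape hP hQ 3 1 2 (by decide) P0 h1 h2 h3
      (by simpa [h1] using f10) (by simpa [h2, h3] using f01)
    obtain ⟨u1, u2⟩ := hw (x 0) (x 3) (x 1) (x 2) (by simpa [P0, h1] using hPx) (by simpa [h2, h3] using hQx)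
    obtain ⟨v1, v2⟩ := hw (y 0) (y 3) (y 1) (y 2) (by simpa [P0, h1] using hPy) (by simpa [h2, h3] using hQy)
    exact ⟨a, b, 3, 1, 2, ha, hb, by simp, u1, u2, v1, v2⟩

/-- Passing from `(x,y) = (α,β) N` to `(α,β) = (x,y) N⁻¹`. -/
theorem invert_pair {K : Type} [Field K] (x y α β : S K) (n00 n01 n10 n11 : K)
    (hx : x = C n00 * α + C n10 * β) (hy : y = C n01 * α + C n11 * β)
    (hli : ∀ g h : K, C g * x + C h * y = 0 → g = 0 ∧ h = 0) :
    ∃ G : Matrix (Fin 2) (Fin 2) K, G.det ≠ 0 ∧ α = C (G 0 0) * x + C (G 1 0) * y ∧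
      β = C (G 0 1) * x + C (G 1 1) * y := by
  have hd : n00 * n11 - n01 * n10 ≠ 0 := by
    intro hd
    have hC : (C n00 * C n11 - C n01 * C n10 : S K) = 0 := by
      rw [← C_mul, ← C_mul, ← C_sub, hd, C_0]
    obtain ⟨e1, e2⟩ := hli n11 (-n10) (by
      rw [hx, hy, C_neg]; linear_combination α * hC)
    obtain ⟨e3, e4⟩ := hli n01 (-n00) (by
      rw [hx, hy, C_neg]; linear_combination (-β) * hC)
    have e2' : n10 = 0 := by simpa using e2
    have e4' : n00 = 0 := by simpa using e4
    have := (hli 1 0 (by rw [hx, e2', e4']; simp)).1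
    exact one_ne_zero this
  set e := (n00 * n11 - n01 * n10)⁻¹ with he
  have hC : (C e * (C n00 * C n11 - C n01 * C n10) : S K) = 1 := by
    rw [← C_mul, ← C_mul, ← C_sub, ← C_mul, he, inv_mul_cancel₀ hd, C_1]
  refine ⟨!![e * n11, -(e * n01); -(e * n10), e * n00], ?_, ?_, ?_⟩
  · have : (!![e * n11, -(e * n01); -(e * n10), e * n00]).det = e := by
      rw [Matrix.det_fin_two_of]
      have : e * (n00 * n11 - n01 * n10) = 1 := inv_mul_cancel₀ hd
      linear_combination e * this
    rw [this]
    exact inv_ne_zero hd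
  · simp only [Matrix.of_apply, Matrix.cons_val', Matrix.cons_val_zero, Matrix.cons_val_one, Matrix.cons_val_fin_one, C_mul, C_neg]
    rw [hx, hy]
    linear_combination (-α) * hC
  · simp only [Matrix.of_apply, Matrix.cons_val', Matrix.cons_val_zero, Matrix.cons_val_one, Matrix.cons_val_fin_one, C_mul, C_neg]
    rw [hx, hy]
    linear_combination (-β) * hC

theorem classify {K : Type} [Field K] [CharZero K] (x y : S K)
    (hx : x.IsHomogeneous 1) (hy : y.IsHomogeneous 1)
    (h : ∀ P : Fin 4 → K, eval P x = 0 → eval P y = 0 → eval P (f4 K) = 0)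
    (hli : ∀ g h : K, C g * x + C h * y = 0 → g = 0 ∧ h = 0) :
    ∃ (j : ℕ) (α β : S K) (G : Matrix (Fin 2) (Fin 2) K), j ∈ ({2, 3, 4} : Set ℕ) ∧
      α ∈ Lset K 1 ∧ β ∈ Lset K j ∧ G.det ≠ 0 ∧
      α = C (G 0 0) * x + C (G 1 0) * y ∧ β = C (G 0 1) * x + C (G 1 1) * y := by
  obtain ⟨cx, rx⟩ := lin_form hx
  obtain ⟨cy, ry⟩ := lin_form hy
  obtain ⟨a, b, s, j, k, ha, hb, hsjk, h1, h2, h3, h4⟩ := classify_num cx cy (by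
    intro P h1 h2
    rw [← eval_f4]
    simp only [dotProduct, Fin.sum_univ_four] at h1 h2
    exact h P (by simpa [rx] using h1) (by simpa [ry] using h2))
  have main : ∃ G : Matrix (Fin 2) (Fin 2) K, G.det ≠ 0 ∧
      (X 0 - C a * X s : S K) = C (G 0 0) * x + C (G 1 0) * y ∧
      (X j - C b * X k : S K) = C (G 0 1) * x + C (G 1 1) * y := by
    apply invert_pair x y _ _ (cx 0) (cy 0) (cx j) (cy j) _ _ hli
    · rw [rx]
      rcases hsjk with ⟨rfl, rfl, rfl⟩ | ⟨rfl, rfl, rfl⟩ | ⟨rfl, rfl, rfl⟩ <;>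
      · rw [h1, h2]; simp only [C_mul, C_neg]; ring
    · rw [ry]
      rcases hsjk with ⟨rfl, rfl, rfl⟩ | ⟨rfl, rfl, rfl⟩ | ⟨rfl, rfl, rfl⟩ <;>
      · rw [h3, h4]; simp only [C_mul, C_neg]; ring
  obtain ⟨G, hG, e1, e2⟩ := main
  rcases hsjk with ⟨rfl, rfl, rfl⟩ | ⟨rfl, rfl, rfl⟩ | ⟨rfl, rfl, rfl⟩
  · exact ⟨3, _, _, G, by simp, ⟨a, 2, ha, by norm_num, by norm_num, rfl⟩,
      ⟨b, 4, hb, by norm_num, by norm_num, rfl⟩, hG, e1, e2⟩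
  · exact ⟨2, _, _, G, by simp, ⟨a, 3, ha, by norm_num, by norm_num, rfl⟩,
      ⟨b, 4, hb, by norm_num, by norm_num, rfl⟩, hG, e1, e2⟩
  · exact ⟨2, _, _, G, by simp, ⟨a, 4, ha, by norm_num, by norm_num, rfl⟩,
      ⟨b, 3, hb, by norm_num, by norm_num, rfl⟩, hG, e1, e2⟩

/-- Constant matrices act on matrices of linear forms. -/
theorem hom_conj {K : Type} [Field K] (φ : Matrix (Fin 3) (Fin 3) (S K))
    (hhom : ∀ k l, (φ k l).IsHomogeneous 1) (P Q : Matrix (Fin 3) (Fin 3) K) (k l : Fin 3) :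
    ((P.map (C : K →+* S K) * φ * Q.map (C : K →+* S K) : Matrix (Fin 3) (Fin 3) (S K)) k l).IsHomogeneous 1 := by
  rw [Matrix.mul_apply]
  refine IsHomogeneous.sum _ _ _ fun i _ => ?_
  rw [Matrix.mul_apply, Matrix.map_apply, mul_comm]
  refine IsHomogeneous.C_mul (IsHomogeneous.sum _ _ _ fun j _ => ?_) _
  rw [Matrix.map_apply]
  exact IsHomogeneous.C_mul (hhom _ _) _

theorem det_map_C {K : Type} [Field K] (P : Matrix (Fin 3) (Fin 3) K) :
    (P.map (C : K →+* S K)).det = C P.det := by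
  rw [RingHom.map_det]; rfl

theorem exists_uv {K : Type} [Field K] [IsAlgClosed K] [CharZero K]
    (φ : Matrix (Fin 3) (Fin 3) (S K))
    (hhom : ∀ k l, (φ k l).IsHomogeneous 1) (hdet : φ.det = f4 K) :
    ∃ P Q : Matrix (Fin 3) (Fin 3) K, P.det ≠ 0 ∧ Q.det ≠ 0 ∧
      (P.map (C : K →+* S K) * φ * Q.map (C : K →+* S K) : Matrix (Fin 3) (Fin 3) (S K)) 0 0 = 0 := by
  choose c hc using fun k l => lin_form (hhom k l)
  let A : Fin 4 → Matrix (Fin 3) (Fin 3) K := fun i => Matrix.of fun k l => c k l i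
  have hev : ∀ Z : Fin 4 → K, φ.map (eval Z) = Z 0 • A 0 + Z 1 • A 1 + Z 2 • A 2 + Z 3 • A 3 := by
    intro Z
    ext k l
    rw [Matrix.map_apply, hc k l]
    simp [A]; ring
  have hdetev : ∀ Z : Fin 4 → K, (Z 0 • A 0 + Z 1 • A 1 + Z 2 • A 2 + Z 3 • A 3).det
      = Z 0 ^ 3 + Z 1 ^ 3 + Z 2 ^ 3 + Z 3 ^ 3 := by
    intro Z
    rw [← hev, ← eval_f4, ← hdet, RingHom.map_det]; rfl
  obtain ⟨u, v, hu, hv, h1, h2, h3, h4⟩ := core (A 0 - A 1) (A 2 - A 3) (A 0) (A 2) (by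
    intro s t p
    have := hdetev ![s + p, -s, t, -t]
    simp only [Matrix.cons_val] at this
    have e : s • (A 0 - A 1) + t • (A 2 - A 3) + p • A 0
      = (s + p) • A 0 + (-s) • A 1 + t • A 2 + (-t) • A 3 := by module
    rw [e, this]; ring)
  rw [Matrix.sub_mulVec, dotProduct_sub] at h1 h2
  obtain ⟨P, hP, hPu⟩ := exists_row u hu
  obtain ⟨Q, hQ, hQv⟩ := exists_row v hv
  refine ⟨P, Qᵀ, hP, by simpa using hQ, ?_⟩
  apply MvPolynomial.funext
  intro Z
  have e1 : eval Z ((P.map (C : K →+* S K) * φ * Qᵀ.map (C : K →+* S K) : Matrix (Fin 3) (Fin 3) (S K)) 0 0) = u ⬝ᵥ (φ.map (eval Z) *ᵥ v) := by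
    rw [← hPu, ← hQv]
    simp [Matrix.mul_apply, Matrix.mulVec, dotProduct, Fin.sum_univ_three]
    ring
  rw [e1, hev]
  simp only [Matrix.add_mulVec, Matrix.smul_mulVec, dotProduct_add, dotProduct_smul]
  have h1' : u ⬝ᵥ A 1 *ᵥ v = 0 := by rw [h3] at h1; simpa using h1
  have h2' : u ⬝ᵥ A 3 *ᵥ v = 0 := by rw [h4] at h2; simpa using h2
  simp [h3, h4, h1', h2']

theorem li_pair {K : Type} [Field K] {x y z p : S K} (h : LinearIndependent K ![x, y, z, p]) :
    (∀ g h : K, C g * x + C h * y = 0 → g = 0 ∧ h = 0) ∧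
    (∀ g h : K, C g * z + C h * p = 0 → g = 0 ∧ h = 0) := by
  rw [Fintype.linearIndependent_iff] at h
  constructor
  · intro a b hab
    have := h ![a, b, 0, 0] (by simpa [Fin.sum_univ_four, MvPolynomial.smul_eq_C_mul] using hab)
    exact ⟨this 0, this 1⟩
  · intro a b hab
    have := h ![0, 0, a, b] (by simpa [Fin.sum_univ_four, MvPolynomial.smul_eq_C_mul] using hab)
    exact ⟨this 2, this 3⟩

theorem stmt9 (K : Type) [Field K] [IsAlgClosed K] [CharZero K]
    (φ : Matrix (Fin 3) (Fin 3) (S K))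
    (hhom : ∀ k l, (φ k l).IsHomogeneous 1) (hdet : φ.det = f4 K) :
    ∃ (U V : Matrix (Fin 3) (Fin 3) (S K)) (i j : ℕ) (α β γ δ m n w t : S K),
      U.det = 1 ∧ V.det = 1 ∧
      i ∈ ({2, 3, 4} : Set ℕ) ∧ j ∈ ({2, 3, 4} : Set ℕ) ∧
      α ∈ Lset K 1 ∧ γ ∈ Lset K 1 ∧ β ∈ Lset K j ∧ δ ∈ Lset K i ∧
      LinearIndependent K ![α, β, γ, δ] ∧
      m.IsHomogeneous 1 ∧ n.IsHomogeneous 1 ∧ w.IsHomogeneous 1 ∧ t.IsHomogeneous 1 ∧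
      U * φ * V = !![0, α, β; γ, m, n; δ, w, t] := by
  obtain ⟨P, Q, hP, hQ, h00⟩ := exists_uv φ hhom hdet
  set ψ : Matrix (Fin 3) (Fin 3) (S K) := P.map (C : K →+* S K) * φ * Q.map (C : K →+* S K) with hψ
  have hψhom : ∀ k l, (ψ k l).IsHomogeneous 1 := hom_conj φ hhom P Q
  have expand : ∀ M : Matrix (Fin 3) (Fin 3) (S K), M 0 0 = 0 → M.det =
      -(M 0 1) * (M 1 0 * M 2 2 - M 1 2 * M 2 0) + M 0 2 * (M 1 0 * M 2 1 - M 1 1 * M 2 0) := by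
    intro M hM
    rw [Matrix.det_fin_three, hM]; ring
  have hψdet : C (P.det * Q.det) * f4 K =
      -(ψ 0 1) * (ψ 1 0 * ψ 2 2 - ψ 1 2 * ψ 2 0) + ψ 0 2 * (ψ 1 0 * ψ 2 1 - ψ 1 1 * ψ 2 0) := by
    rw [← expand ψ h00, hψ, Matrix.det_mul, Matrix.det_mul, det_map_C, det_map_C, hdet, C_mul]
    ring
  have hPQ : P.det * Q.det ≠ 0 := mul_ne_zero hP hQ
  have hli := indep _ _ _ _ _ _ _ _ _ hPQ (hψhom 0 1) (hψhom 0 2) (hψhom 1 0) (hψhom 2 0) hψdet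
  obtain ⟨li1, li2⟩ := li_pair hli
  have evf : ∀ Z : Fin 4 → K, (eval Z (ψ 0 1) = 0 ∧ eval Z (ψ 0 2) = 0) ∨
      (eval Z (ψ 1 0) = 0 ∧ eval Z (ψ 2 0) = 0) → eval Z (f4 K) = 0 := by
    intro Z hZ
    have := congrArg (eval Z) hψdet
    rcases hZ with ⟨h1, h2⟩ | ⟨h1, h2⟩ <;>
    · simp only [map_mul, eval_C, map_add, map_neg, map_sub, h1, h2] at this
      have this : P.det * Q.det * eval Z (f4 K) = 0 := by rw [this]; ring
      exact (mul_eq_zero.mp this).resolve_left hPQ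
  obtain ⟨j, α, β, G, hj, hα, hβ, hG, eα, eβ⟩ := classify (ψ 0 1) (ψ 0 2) (hψhom _ _) (hψhom _ _)
    (fun Z h1 h2 => evf Z (Or.inl ⟨h1, h2⟩)) li1
  obtain ⟨i, γ, δ, H, hi, hγ, hδ, hH, eγ, eδ⟩ := classify (ψ 1 0) (ψ 2 0) (hψhom _ _) (hψhom _ _)
    (fun Z h1 h2 => evf Z (Or.inr ⟨h1, h2⟩)) li2
  -- normalising the determinants
  obtain ⟨r, hr⟩ := IsAlgClosed.exists_pow_nat_eq ((H.det * P.det) ^ 2 * (G.det * Q.det))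
    (n := 3) (by norm_num)
  have hh : H.det * P.det ≠ 0 := mul_ne_zero hH hP
  have hg : G.det * Q.det ≠ 0 := mul_ne_zero hG hQ
  have hr0 : r ≠ 0 := by
    rintro rfl
    have : (H.det * P.det) ^ 2 * (G.det * Q.det) ≠ 0 := mul_ne_zero (pow_ne_zero _ hh) hg
    exact this (by rw [← hr]; ring)
  obtain ⟨s, hs⟩ : ∃ s, s = r ^ 2 / (H.det * P.det) := ⟨_, rfl⟩
  have hs0 : s ≠ 0 := by rw [hs]; exact div_ne_zero (pow_ne_zero _ hr0) hh
  let U0 : Matrix (Fin 3) (Fin 3) K :=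
    !![s, 0, 0; 0, r⁻¹ * H 0 0, r⁻¹ * H 1 0; 0, r⁻¹ * H 0 1, r⁻¹ * H 1 1]
  let V0 : Matrix (Fin 3) (Fin 3) K :=
    !![r, 0, 0; 0, s⁻¹ * G 0 0, s⁻¹ * G 0 1; 0, s⁻¹ * G 1 0, s⁻¹ * G 1 1]
  have hs1 : s * (H.det * P.det) = r ^ 2 := by rw [hs]; field_simp
  have hU0 : U0.det * P.det = 1 := by
    have : U0.det = s * r⁻¹ ^ 2 * H.det := by
      simp only [U0, Matrix.det_fin_three, Matrix.det_fin_two]; simp; ring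
    rw [this]; field_simp; linear_combination hs1
  have hs2 : r * (G.det * Q.det) = s ^ 2 := by
    have h1 : (H.det * P.det) ^ 2 * (r * (G.det * Q.det)) = (H.det * P.det) ^ 2 * s ^ 2 := by
      linear_combination (-r) * hr - (s * (H.det * P.det) + r ^ 2) * hs1
    exact mul_left_cancel₀ (pow_ne_zero 2 hh) h1
  have hV0 : V0.det * Q.det = 1 := by
    have : V0.det = r * s⁻¹ ^ 2 * G.det := by
      simp only [V0, Matrix.det_fin_three, Matrix.det_fin_two]; simp; ring
    rw [this]; field_simp; linear_combination hs2
  have rC : (C r⁻¹ * C r : S K) = 1 := by rw [← C_mul, inv_mul_cancel₀ hr0, C_1]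
  have sC : (C s⁻¹ * C s : S K) = 1 := by rw [← C_mul, inv_mul_cancel₀ hs0, C_1]
  set M : Matrix (Fin 3) (Fin 3) (S K) := U0.map (C : K →+* S K) * ψ * V0.map (C : K →+* S K) with hM
  have hMhom : ∀ k l, (M k l).IsHomogeneous 1 := hom_conj ψ hψhom U0 V0
  have m00 : M 0 0 = 0 := by
    simp [hM, U0, V0, Matrix.mul_apply, Fin.sum_univ_three, h00]
  have m01 : M 0 1 = α := by
    rw [eα]
    simp [hM, U0, V0, Matrix.mul_apply, Fin.sum_univ_three]
    linear_combination (C (G 0 0) * ψ 0 1 + C (G 1 0) * ψ 0 2) * sC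
  have m02 : M 0 2 = β := by
    rw [eβ]
    simp [hM, U0, V0, Matrix.mul_apply, Fin.sum_univ_three]
    linear_combination (C (G 0 1) * ψ 0 1 + C (G 1 1) * ψ 0 2) * sC
  have m10 : M 1 0 = γ := by
    rw [eγ]
    simp [hM, U0, V0, Matrix.mul_apply, Fin.sum_univ_three]
    linear_combination (C (H 0 0) * ψ 1 0 + C (H 1 0) * ψ 2 0) * rC
  have m20 : M 2 0 = δ := by
    rw [eδ]
    simp [hM, U0, V0, Matrix.mul_apply, Fin.sum_univ_three]
    linear_combination (C (H 0 1) * ψ 1 0 + C (H 1 1) * ψ 2 0) * rC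
  have dU : (U0.map (C : K →+* S K) * P.map (C : K →+* S K)).det = 1 := by
    rw [Matrix.det_mul, det_map_C, det_map_C, ← C_mul, hU0, C_1]
  have dV : (Q.map (C : K →+* S K) * V0.map (C : K →+* S K)).det = 1 := by
    rw [Matrix.det_mul, det_map_C, det_map_C, ← C_mul, mul_comm, hV0, C_1]
  have hMeq : (U0.map (C : K →+* S K) * P.map (C : K →+* S K)) * φ *
      (Q.map (C : K →+* S K) * V0.map (C : K →+* S K)) = M := by
    rw [hM, hψ]; simp only [Matrix.mul_assoc]
  have hMdet : C (1 : K) * f4 K =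
      -(M 0 1) * (M 1 0 * M 2 2 - M 1 2 * M 2 0) + M 0 2 * (M 1 0 * M 2 1 - M 1 1 * M 2 0) := by
    rw [← expand M m00, ← hMeq, Matrix.det_mul, Matrix.det_mul, dU, dV, hdet, C_1]; ring
  have hMli := indep _ _ _ _ _ _ _ _ _ one_ne_zero (hMhom 0 1) (hMhom 0 2) (hMhom 1 0) (hMhom 2 0) hMdet
  rw [m01, m02, m10, m20] at hMli
  refine ⟨_, _, i, j, α, β, γ, δ, M 1 1, M 1 2, M 2 1, M 2 2, dU, dV, hi, hj, hα, hγ, hβ, hδ, hMli,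
    hMhom _ _, hMhom _ _, hMhom _ _, hMhom _ _, ?_⟩
  rw [hMeq, ← m01, ← m02, ← m10, ← m20]
  conv_lhs => rw [Matrix.eta_fin_three M, m00]
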